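/- arXiv:2507.04071 — 3 statements merged into one kernel-verified Lean document; each statement's English description precedes it below -/
import Mathlib

section
/- Substitutivity: for any interpretation ⟦·⟧, any variable x and any terms S, T, ⟦S[T/x]⟧ = ⟦S⟧_{⟨⟦T⟧,x⟩}, i.e. interpreting the substituted term equals interpreting S after modifying the assignment to send x to ⟦T⟧. -/
namespace Paper

/-- Terms of the bare bones dependent type system (Part 1): constants `c n`,
variables `v n`, dependent products `ρR`, applications `βRS` and abstractions `λxRS`. -/
inductive Tm : Type
  | const : ℕ → Tm
  | var : ℕ → Tm
  | rho : Tm → Tm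
  | app : Tm → Tm → Tm
  | lam : ℕ → Tm → Tm → Tm
  deriving DecidableEq

namespace Tm

/-- The size of a term. -/
def size : Tm → ℕ
  | const _ => 1
  | var _ => 1
  | rho R => R.size + 1
  | app R S => R.size + S.size + 1
  | lam _ R S => R.size + S.size + 1

/-- The free variables `F(T)` of a term. -/
def fv : Tm → Finset ℕ
  | const _ => ∅
  | var x => {x}
  | rho R => R.fv
  | app R S => R.fv ∪ S.fv
  | lam x R S => R.fv ∪ (S.fv \ {x})

/-- The bound variables `B(T)` of a term. -/
def bv : Tm → Finset ℕ
  | const _ => ∅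
  | var _ => ∅
  | rho R => R.bv
  | app R S => R.bv ∪ S.bv
  | lam x R S => (R.bv ∪ S.bv) ∪ {x}

/-- All variables `V(T) = F(T) ∪ B(T)` occurring in a term. -/
def vars (t : Tm) : Finset ℕ := t.fv ∪ t.bv

/-- A fixed choice of a variable outside a given finite set of variables. -/
def fresh (s : Finset ℕ) : ℕ := s.sup id + 1

theorem fresh_not_mem (s : Finset ℕ) : fresh s ∉ s := by
  intro h
  have := Finset.le_sup (f := id) h
  simp only [id] at this
  simp only [fresh] at this
  omega

/-- Capture-avoiding renaming `S[z/y]` (substitution of the variable `z` for the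
variable `y`), implemented with a fuel parameter and carrying the fact that it
preserves the size of the term. -/
def renameAux : (n : ℕ) → (S : Tm) → S.size ≤ n → (z y : ℕ) → {t : Tm // t.size = S.size}
  | _, const a, _, _, _ => ⟨const a, rfl⟩
  | _, var v, _, z, y => if v = y then ⟨var z, rfl⟩ else ⟨var v, rfl⟩
  | 0, rho _, h, _, _ => absurd h (by simp only [size]; omega)
  | n + 1, rho R, h, z, y =>
      let R' := renameAux n R (by simp only [size] at h; omega) z y
      ⟨rho R'.1, by simp only [size, R'.2]⟩
  | 0, app _ _, h, _, _ => absurd h (by simp only [size]; omega)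
  | n + 1, app R S, h, z, y =>
      let R' := renameAux n R (by simp only [size] at h; omega) z y
      let S' := renameAux n S (by simp only [size] at h; omega) z y
      ⟨app R'.1 S'.1, by simp only [size, R'.2, S'.2]⟩
  | 0, lam _ _ _, h, _, _ => absurd h (by simp only [size]; omega)
  | n + 1, lam w R S, h, z, y =>
      let R' := renameAux n R (by simp only [size] at h; omega) z y
      if w = y ∨ y ∉ S.fv then
        ⟨lam w R'.1 S, by simp only [size, R'.2]⟩
      else if w ≠ z then
        -- here `w ∉ F(z)`, so the chosen fresh variable is `w` itself
        let S' := renameAux n S (by simp only [size] at h; omega) z y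
        ⟨lam w R'.1 S'.1, by simp only [size, R'.2, S'.2]⟩
      else
        let z' := fresh ((var z).vars ∪ S.vars)
        let S₁ := renameAux n S (by simp only [size] at h; omega) z' w
        let S₂ := renameAux n S₁.1 (by rw [S₁.2]; simp only [size] at h; omega) z y
        ⟨lam z' R'.1 S₂.1, by simp only [size, S₂.2, S₁.2, R'.2]⟩

/-- Capture-avoiding renaming `S[z/y]` of the variable `y` to the variable `z`. -/
def rename (S : Tm) (z y : ℕ) : Tm := (renameAux S.size S le_rfl z y).1

theorem size_rename (S : Tm) (z y : ℕ) : (rename S z y).size = S.size :=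
  (renameAux S.size S le_rfl z y).2

/-- Capture-avoiding substitution `S[T/x]` of the term `T` for the variable `x` in `S`,
renaming bound variables (using the fixed choice `fresh`) to avoid capture. -/
def subst : Tm → Tm → ℕ → Tm
  | const a, _, _ => const a
  | var v, T, x => if v = x then T else var v
  | rho R, T, x => rho (subst R T x)
  | app R S, T, x => app (subst R T x) (subst S T x)
  | lam w R S, T, x =>
      if w = x ∨ x ∉ S.fv then lam w (subst R T x) S
      else if w ∉ T.fv then lam w (subst R T x) (subst S T x)
      else lam (fresh (T.vars ∪ S.vars)) (subst R T x)
        (subst (rename S (fresh (T.vars ∪ S.vars)) w) T x)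
termination_by S _ _ => S.size
decreasing_by all_goals (simp only [size, size_rename]; omega)

end Tm

end Paper
namespace Paper

open ZFSet

/-- The application `R(s) = ⋃ R{s} = ⋃ {r | ⟨r,s⟩ ∈ R}` of a set to a set
(ordered pairs `⟨r,s⟩` are Kuratowski pairs `ZFSet.pair r s`). -/
noncomputable def sApp (R s : ZFSet.{0}) : ZFSet :=
  ⋃₀ (ZFSet.sep (fun r => ZFSet.pair r s ∈ R) (⋃₀ (⋃₀ R)))

/-- The domain `dom(S) = {d | ∃ r, ⟨r,d⟩ ∈ S}` of a set. -/
noncomputable def sDom (S : ZFSet.{0}) : ZFSet :=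
  ZFSet.sep (fun d => ∃ r, ZFSet.pair r d ∈ S) (⋃₀ (⋃₀ S))

/-- The range `ran(S) = {r | ∃ d, ⟨r,d⟩ ∈ S}` of a set. -/
noncomputable def sRan (S : ZFSet.{0}) : ZFSet :=
  ZFSet.sep (fun r => ∃ d, ZFSet.pair r d ∈ S) (⋃₀ (⋃₀ S))

/-- `F` is a function: a set of ordered pairs `⟨value, argument⟩` which, for each
`d` in its domain, contains a unique pair with second component `d`. -/
def IsFun (F : ZFSet.{0}) : Prop :=
  (∀ p ∈ F, ∃ r d, p = ZFSet.pair r d) ∧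
    ∀ d r r', ZFSet.pair r d ∈ F → ZFSet.pair r' d ∈ F → r = r'

/-- The dependent product `∏F`: the set of all functions `f` with `dom f = dom F`
such that `f(d) ∈ F(d)` for every `d ∈ dom F` (with the paper's convention that
functions are sets of pairs `⟨value, argument⟩`). -/
noncomputable def dprod (F : ZFSet.{0}) : ZFSet :=
  ZFSet.sep
    (fun f => IsFun f ∧ sDom f = sDom F ∧ ∀ d ∈ sDom F, sApp f d ∈ sApp F d)
    (ZFSet.powerset (ZFSet.prod (⋃₀ (sRan F)) (sDom F)))

/-- The set `{⟨f r, r⟩ : r ∈ X}`, i.e. the graph (in the paper's convention) of the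
function sending each `r ∈ X` to `f r`. -/
noncomputable def lamSet (X : ZFSet.{0}) (f : ZFSet.{0} → ZFSet.{0}) : ZFSet :=
  @ZFSet.image (fun r => ZFSet.pair (f r) r) (Classical.allZFSetDefinable _) X

/-- An assignment of sets to the constants and the variables. -/
structure Asn where
  c : ℕ → ZFSet.{0}
  v : ℕ → ZFSet.{0}

/-- The assignment modified to send the variable `x` to the set `s`. -/
noncomputable def Asn.update (A : Asn) (x : ℕ) (s : ZFSet.{0}) : Asn :=
  ⟨A.c, Function.update A.v x s⟩

/-- The interpretation `⟦·⟧` of terms determined by an assignment: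
`⟦ρS⟧ = ∏⟦S⟧`, `⟦βRS⟧ = ⟦R⟧(⟦S⟧)` and `⟦λxRS⟧ = {⟨⟦S⟧_{⟨r,x⟩}, r⟩ : r ∈ ⟦R⟧}`. -/
noncomputable def interp : Tm → Asn → ZFSet
  | Tm.const a, A => A.c a
  | Tm.var x, A => A.v x
  | Tm.rho R, A => dprod (interp R A)
  | Tm.app R S, A => sApp (interp R A) (interp S A)
  | Tm.lam x R S, A => lamSet (interp R A) (fun r => interp S (A.update x r))

end Paper

namespace Paper

/-- The interpretation depends only on the values of the constants and free variables. -/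
theorem interp_congr (S : Tm) (A B : Asn) (hc : A.c = B.c)
    (hv : ∀ y ∈ S.fv, A.v y = B.v y) : interp S A = interp S B := by
  induction S generalizing A B with
  | const a => simp only [interp, hc]
  | var v => exact hv v (by simp [Tm.fv])
  | rho R ih => simp only [interp, ih A B hc hv]
  | app R S ihR ihS =>
    simp only [interp, ihR A B hc fun y hy => hv y (by simp [Tm.fv, hy]),
      ihS A B hc fun y hy => hv y (by simp [Tm.fv, hy])]
  | lam w R S ihR ihS =>
    simp only [interp]
    congr 1
    · exact ihR A B hc fun y hy => hv y (by simp [Tm.fv, hy])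
    · funext r
      refine ihS _ _ hc fun y hy => ?_
      by_cases h : y = w
      · subst h; simp [Asn.update]
      · simpa [Asn.update, h] using hv y (by simp [Tm.fv, hy, h])

theorem interp_update_of_notMem_fv (S : Tm) (A : Asn) (x : ℕ) (s : ZFSet.{0})
    (hx : x ∉ S.fv) : interp S (A.update x s) = interp S A := by
  refine interp_congr _ _ _ rfl fun y hy => ?_
  have h : y ≠ x := fun h => hx (h ▸ hy)
  simp [Asn.update, h]

theorem Asn.update_comm (A : Asn) {x y : ℕ} (h : x ≠ y) (s t : ZFSet.{0}) :
    (A.update x s).update y t = (A.update y t).update x s := by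
  simp only [Asn.update, Function.update_comm h]

theorem Asn.update_idem (A : Asn) (x : ℕ) (s t : ZFSet.{0}) :
    (A.update x s).update x t = A.update x t := by
  simp only [Asn.update, Function.update_idem]

/-- Updating `x` does not affect the body of an abstraction in which it is not free. -/
theorem interp_update_update_of_shadowed (S : Tm) (A : Asn) {w x : ℕ} (s r : ZFSet.{0})
    (h : w = x ∨ x ∉ S.fv) :
    interp S (A.update w r) = interp S ((A.update x s).update w r) := by
  by_cases hw : w = x
  · rw [hw, Asn.update_idem]
  · rw [Asn.update_comm A (Ne.symm hw),
      interp_update_of_notMem_fv _ _ _ _ (h.resolve_left hw)]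

theorem Tm.fresh_vars_union (T S : Tm) :
    fresh (T.vars ∪ S.vars) ∉ T.fv ∧ fresh (T.vars ∪ S.vars) ∉ S.fv := by
  have h := fresh_not_mem (T.vars ∪ S.vars)
  simp only [vars, Finset.mem_union, not_or] at h ⊢
  exact ⟨h.1.1, h.2.1⟩

theorem interp_renameAux (n : ℕ) (S : Tm) (h : S.size ≤ n) (z y : ℕ) (A : Asn) :
    interp (Tm.renameAux n S h z y).1 A = interp S (A.update y (A.v z)) := by
  induction n generalizing S z y A with
  | zero => cases S <;> simp [Tm.size] at h
  | succ n ih =>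
    cases S with
    | const a => simp [Tm.renameAux, interp, Asn.update]
    | var v =>
      simp only [Tm.renameAux]
      split_ifs with hv
      · subst hv; simp [interp, Asn.update]
      · simp [interp, Asn.update, hv]
    | rho R => simp only [Tm.renameAux, interp, ih]
    | app R S => simp only [Tm.renameAux, interp, ih]
    | lam w R S =>
      simp only [Tm.renameAux]
      split_ifs with h₁ h₂
      · simp only [interp, ih]
        congr 1
        funext r
        exact interp_update_update_of_shadowed S A _ r h₁
      · simp only [interp, ih]
        congr 1
        funext r
        rw [Asn.update_comm A (fun e => h₁ (Or.inl e))]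
        simp [Asn.update, Ne.symm h₂]
      · simp only [interp, ih]
        congr 1
        funext r
        push Not at h₁ h₂
        obtain ⟨hz, hS⟩ := Tm.fresh_vars_union (Tm.var z) S
        generalize Tm.fresh ((Tm.var z).vars ∪ S.vars) = u at hz hS ⊢
        have huz : u ≠ z := by simpa [Tm.fv] using hz
        have huy : u ≠ y := fun e => hS (e ▸ h₁.2)
        have hv : (A.update u r).v z = A.v z := by simp [Asn.update, huz.symm]
        have hu : ((A.update u r).update y (A.v z)).v u = r := by simp [Asn.update, huy]
        rw [hv, hu, Asn.update_comm A huy, Asn.update_comm _ (h₂ ▸ huz),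
          interp_update_of_notMem_fv _ _ _ _ hS]

theorem interp_rename (S : Tm) (z y : ℕ) (A : Asn) :
    interp (S.rename z y) A = interp S (A.update y (A.v z)) :=
  interp_renameAux _ _ _ _ _ _

/-- Substitutivity: `⟦S[T/x]⟧ = ⟦S⟧_{⟨⟦T⟧,x⟩}`. -/
theorem interp_subst (A : Asn) (x : ℕ) (S T : Tm) :
    interp (S.subst T x) A = interp S (A.update x (interp T A)) := by
  induction hn : S.size using Nat.strong_induction_on generalizing S A with
  | _ n ih =>
    subst hn
    cases S with
    | const a => simp [Tm.subst, interp, Asn.update]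
    | var v =>
      rw [Tm.subst]
      split_ifs with hv
      · subst hv; simp [interp, Asn.update]
      · simp [interp, Asn.update, hv]
    | rho R =>
      simp only [Tm.subst, interp]
      rw [ih _ (by simp only [Tm.size]; omega) _ R rfl]
    | app R S =>
      simp only [Tm.subst, interp]
      rw [ih _ (by simp only [Tm.size]; omega) _ R rfl,
        ih _ (by simp only [Tm.size]; omega) _ S rfl]
    | lam w R S =>
      have hR := ih _ (by simp only [Tm.size]; omega) A R rfl
      rw [Tm.subst]
      split_ifs with h₁ h₂ <;> simp only [interp, hR] <;> congr 1 <;> funext r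
      · exact interp_update_update_of_shadowed S A _ r h₁
      · push Not at h₁
        obtain ⟨hT, hS⟩ := Tm.fresh_vars_union T S
        generalize Tm.fresh (T.vars ∪ S.vars) = u at hT hS ⊢
        have hux : u ≠ x := fun e => hS (e ▸ h₁.2)
        rw [ih _ (by simp only [Tm.size, Tm.size_rename]; omega) _ (S.rename u w) rfl,
          interp_rename, interp_update_of_notMem_fv _ _ _ _ hT]
        have hu : ((A.update u r).update x (interp T A)).v u = r := by
          simp [Asn.update, hux]
        rw [hu, Asn.update_comm A hux]
        by_cases huw : u = w
        · rw [huw, Asn.update_idem]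
        · rw [Asn.update_comm _ huw, interp_update_of_notMem_fv _ _ _ _ hS]
      · rw [ih _ (by simp only [Tm.size]; omega) _ S rfl,
          interp_update_of_notMem_fv _ _ _ _ h₂,
          Asn.update_comm A (fun e => h₁ (Or.inl e))]

end Paper
end

section
/- The head α-conversion relation ≡^α = {⟨λxRS, λyR(S[y/x])⟩ : R, S terms, x ∉ B(S), y ∉ V(S)} is symmetric: if ⟨A,B⟩ ∈ ≡^α then ⟨B,A⟩ ∈ ≡^α. -/
namespace Paper

/-- The head α-conversion relation
`≡^α = {⟨λxRS, λyR(S[y/x])⟩ : x ∉ B(S) and y ∉ V(S)}`. -/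
def HeadAlpha (A B : Tm) : Prop :=
  ∃ (x y : ℕ) (R S : Tm), x ∉ S.bv ∧ y ∉ S.vars ∧
    A = Tm.lam x R S ∧ B = Tm.lam y R (S.subst (Tm.var y) x)

end Paper

namespace Paper

namespace Tm

theorem subst_eq_self_of_notMem_fv {S T : Tm} {x : ℕ} (hx : x ∉ S.fv) : S.subst T x = S := by
  induction S with
  | const a => simp [subst]
  | var v => simp_all [subst, fv, eq_comm]
  | rho R ih => simp_all [subst, fv]
  | app R S ihR ihS => simp_all [subst, fv]
  | lam w R S ihR ihS =>
    simp only [fv, Finset.mem_union, Finset.mem_sdiff, Finset.mem_singleton, not_or] at hx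
    have h : w = x ∨ x ∉ S.fv := by grind
    rw [subst, if_pos h, ihR hx.1]

theorem subst_var_lam {w x y : ℕ} {R S : Tm} (hx : w ≠ x) (hy : w ≠ y) :
    (lam w R S).subst (var y) x = lam w (R.subst (var y) x) (S.subst (var y) x) := by
  by_cases h : x ∈ S.fv
  · rw [subst, if_neg (by tauto), if_pos (by simpa [fv] using hy)]
  · rw [subst, if_pos (.inr h), subst_eq_self_of_notMem_fv h]

theorem bv_subst_var {S : Tm} {x y : ℕ} (hx : x ∉ S.bv) (hy : y ∉ S.bv) :
    (S.subst (var y) x).bv = S.bv := by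
  induction S with
  | const a => simp [subst]
  | var v => rw [subst]; split <;> rfl
  | rho R ih => simp_all [subst, bv]
  | app R S ihR ihS => simp_all [subst, bv]
  | lam w R S ihR ihS =>
    simp only [bv, Finset.mem_union, Finset.mem_singleton, not_or] at hx hy
    rw [subst_var_lam (Ne.symm hx.2) (Ne.symm hy.2)]
    simp_all [bv]

theorem notMem_fv_subst_var {S : Tm} {x y : ℕ} (hxy : x ≠ y) (hx : x ∉ S.bv) (hy : y ∉ S.bv) :
    x ∉ (S.subst (var y) x).fv := by
  induction S with
  | const a => simp [subst, fv]
  | var v => rw [subst]; split <;> simp_all [fv, eq_comm]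
  | rho R ih => simp_all [subst, fv, bv]
  | app R S ihR ihS => simp_all [subst, fv, bv]
  | lam w R S ihR ihS =>
    simp only [bv, Finset.mem_union, Finset.mem_singleton, not_or] at hx hy
    rw [subst_var_lam (Ne.symm hx.2) (Ne.symm hy.2)]
    simp_all [fv]

theorem subst_var_subst_var {S : Tm} {x y : ℕ} (hx : x ∉ S.bv) (hyb : y ∉ S.bv)
    (hyf : y ∉ S.fv) : (S.subst (var y) x).subst (var x) y = S := by
  induction S with
  | const a => simp [subst]
  | var v => by_cases h : v = x <;> simp_all [subst, fv, eq_comm]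
  | rho R ih => simp_all [subst, fv, bv]
  | app R S ihR ihS => simp_all [subst, fv, bv]
  | lam w R S ihR ihS =>
    simp only [bv, Finset.mem_union, Finset.mem_singleton, not_or] at hx hyb
    rw [subst_var_lam (Ne.symm hx.2) (Ne.symm hyb.2),
      subst_var_lam (Ne.symm hyb.2) (Ne.symm hx.2)]
    simp_all [fv]

end Tm

/-- the head α-conversion relation is symmetric. -/
theorem headAlpha_symm (A B : Tm) : HeadAlpha A B → HeadAlpha B A := by
  rintro ⟨x, y, R, S, hx, hy, rfl, rfl⟩
  obtain ⟨hyf, hyb⟩ : y ∉ S.fv ∧ y ∉ S.bv := by simpa [Tm.vars] using hy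
  refine ⟨y, x, R, S.subst (Tm.var y) x, ?_, ?_, rfl, ?_⟩
  · rwa [Tm.bv_subst_var hx hyb]
  · rcases eq_or_ne x y with rfl | hxy
    · rwa [Tm.subst_eq_self_of_notMem_fv hyf]
    · simp only [Tm.vars, Finset.mem_union, not_or]
      exact ⟨Tm.notMem_fv_subst_var hxy hx hyb, by rwa [Tm.bv_subst_var hx hyb]⟩
  · rw [Tm.subst_var_subst_var hx hyb hyf]

end Paper
end

section
/- For every n ∈ ω, every set of typing statements Γ and every term S, ⌈S⌉^Γ_n = ⋃{⌈S⌉^Φ_n : Φ ⊆ Γ finite}. In particular the typing functions are monotone in Γ and compact. -/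
namespace Paper

/-- The contextual closure of a relation on terms: the smallest relation
containing it such that `R ▷ C` implies `βSR ▷ βSC`, `βRS ▷ βCS`, `λxSR ▷ λxSC`,
`λxRS ▷ λxCS` and `ρR ▷ ρC`. -/
inductive Ctx (r : Tm → Tm → Prop) : Tm → Tm → Prop
  | base {R C : Tm} : r R C → Ctx r R C
  | appLeft {R C S : Tm} : Ctx r R C → Ctx r (Tm.app R S) (Tm.app C S)
  | appRight {R C S : Tm} : Ctx r R C → Ctx r (Tm.app S R) (Tm.app S C)
  | lamDom {R C S : Tm} {x : ℕ} : Ctx r R C → Ctx r (Tm.lam x R S) (Tm.lam x C S)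
  | lamBody {R C S : Tm} {x : ℕ} : Ctx r R C → Ctx r (Tm.lam x S R) (Tm.lam x S C)
  | rho {R C : Tm} : Ctx r R C → Ctx r (Tm.rho R) (Tm.rho C)

/-- α-conversion `≡_α`: the reflexive transitive contextual closure of
head α-conversion. -/
def AlphaEq : Tm → Tm → Prop := Relation.ReflTransGen (Ctx HeadAlpha)

end Paper
namespace Paper

/-- The setoid of α-conversion: the equivalence relation generated by the
contextual closure of head α-conversion (which coincides with `AlphaEq`). -/
def alphaSetoid : Setoid Tm := Relation.EqvGen.setoid (Ctx HeadAlpha)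

/-- α-equivalence classes of terms. -/
def QTm := Quotient alphaSetoid

/-- The α-equivalence class `[T]_α` of a term. -/
def cls (t : Tm) : QTm := Quotient.mk alphaSetoid t

/-- Typing statements `(S : P)`: pairs of α-equivalence classes of terms. -/
abbrev Stmt := QTm × QTm

/-- The free variables of an α-equivalence class, i.e. the union of the free
variables of its representatives (free variables are α-invariant). -/
def Fq (q : QTm) : Set ℕ := {v | ∃ T : Tm, cls T = q ∧ v ∈ T.fv}

/-- The free variables `F(Γ)` of a set of typing statements: the union of the
free variables of the subjects and predicates of its statements. -/
def FSet (Γ : Set Stmt) : Set ℕ := {v | ∃ st ∈ Γ, v ∈ Fq st.1 ∨ v ∈ Fq st.2}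

/-- The product term `πxRS := ρλxRS`. -/
def Tm.pi (x : ℕ) (R S : Tm) : Tm := Tm.rho (Tm.lam x R S)

end Paper
namespace Paper

/-- The α-equivalence class of a term, as a set of terms. -/
def clsSet (T : Tm) : Set Tm := {P | cls P = cls T}

/-- The typing functions `⌈S⌉^Γ_n`. -/
def TypF : ℕ → Set Stmt → Tm → Set Tm
  | 0, Γ, S => {P | (cls S, cls P) ∈ Γ}
  | n + 1, Γ, S =>
    match S with
    | Tm.app F S' =>
        {P | (cls (Tm.app F S'), cls P) ∈ Γ} ∪
          {P' | ∃ (x : ℕ) (P R : Tm),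
            P ∈ TypF n Γ S' ∧ Tm.pi x P R ∈ TypF n Γ F ∧ P' ∈ clsSet (R.subst S' x)}
    | Tm.lam x Q S' =>
        {P | (cls (Tm.lam x Q S'), cls P) ∈ Γ} ∪
          {P' | ∃ Δ ⊆ Γ, ∃ P : Tm, x ∉ FSet Δ ∧ x ∉ Q.fv ∧
            P ∈ TypF n (Δ ∪ {(cls (Tm.var x), cls Q)}) S' ∧ P' ∈ clsSet (Tm.pi x Q P)}
    | t => {P | (cls t, cls P) ∈ Γ}

end Paper

namespace Paper

theorem FSet_mono {Δ Γ : Set Stmt} (h : Δ ⊆ Γ) : FSet Δ ⊆ FSet Γ :=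
  fun _ ⟨st, hst, hv⟩ => ⟨st, h hst, hv⟩

theorem typF_mono {n : ℕ} {Γ Δ : Set Stmt} (S : Tm) (h : Δ ⊆ Γ) :
    TypF n Δ S ⊆ TypF n Γ S := by
  induction n generalizing Γ Δ S with
  | zero => exact fun _ hP => h hP
  | succ n ih =>
    intro P hP
    cases S with
    | const _ | var _ | rho _ => exact h hP
    | app F S =>
      rcases hP with hP | ⟨x, Q, R, hQ, hF, hP⟩
      · exact Or.inl (h hP)
      · exact Or.inr ⟨x, Q, R, ih S h hQ, ih F h hF, hP⟩
    | lam x Q S =>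
      rcases hP with hP | ⟨Θ, hΘ, hP⟩
      · exact Or.inl (h hP)
      · exact Or.inr ⟨Θ, hΘ.trans h, hP⟩

theorem exists_finite_of_mem_typF {n : ℕ} {Γ : Set Stmt} {S P : Tm} (hP : P ∈ TypF n Γ S) :
    ∃ Φ : Set Stmt, Φ ⊆ Γ ∧ Φ.Finite ∧ P ∈ TypF n Φ S := by
  induction n generalizing Γ S P with
  | zero => exact ⟨{(cls S, cls P)}, Set.singleton_subset_iff.2 hP, Set.finite_singleton _, rfl⟩
  | succ n ih =>
    cases S with
    | const _ | var _ | rho _ =>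
      exact ⟨{(cls _, cls P)}, Set.singleton_subset_iff.2 hP, Set.finite_singleton _, rfl⟩
    | app F S =>
      rcases hP with hP | ⟨x, Q, R, hQ, hF, hP⟩
      · exact ⟨{(cls _, cls P)}, Set.singleton_subset_iff.2 hP, Set.finite_singleton _, Or.inl rfl⟩
      · obtain ⟨Φ, hΦ, hΦfin, hQ⟩ := ih hQ
        obtain ⟨Ψ, hΨ, hΨfin, hF⟩ := ih hF
        exact ⟨Φ ∪ Ψ, Set.union_subset hΦ hΨ, hΦfin.union hΨfin,
          Or.inr ⟨x, Q, R, typF_mono S Set.subset_union_left hQ,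
            typF_mono F Set.subset_union_right hF, hP⟩⟩
    | lam x Q S =>
      rcases hP with hP | ⟨Δ, hΔ, R, hxΔ, hxQ, hR, hP⟩
      · exact ⟨{(cls _, cls P)}, Set.singleton_subset_iff.2 hP, Set.finite_singleton _, Or.inl rfl⟩
      · obtain ⟨Φ, hΦ, hΦfin, hR⟩ := ih hR
        have hsub : Φ ⊆ Φ ∩ Δ ∪ {(cls (Tm.var x), cls Q)} := fun st hst =>
          (hΦ hst).imp (fun hstΔ => ⟨hst, hstΔ⟩) id
        exact ⟨Φ ∩ Δ, Set.inter_subset_right.trans hΔ, hΦfin.inter_of_left Δ,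
          Or.inr ⟨Φ ∩ Δ, subset_rfl, R, fun hx => hxΔ (FSet_mono Set.inter_subset_right hx), hxQ,
            typF_mono S hsub hR, hP⟩⟩

/-- `⌈S⌉^Γ_n = ⋃{⌈S⌉^Φ_n : Φ ⊆ Γ finite}`; in particular the typing
functions are monotone in `Γ` and compact. -/
theorem typF_finite :
    (∀ (n : ℕ) (Γ : Set Stmt) (S : Tm),
      TypF n Γ S = {P | ∃ Φ : Set Stmt, Φ ⊆ Γ ∧ Φ.Finite ∧ P ∈ TypF n Φ S}) ∧
    (∀ (n : ℕ) (Γ Δ : Set Stmt) (S : Tm), Δ ⊆ Γ → TypF n Δ S ⊆ TypF n Γ S) :=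
  ⟨fun _ _ S => Set.Subset.antisymm (fun _ hP => exists_finite_of_mem_typF hP)
    (fun _ ⟨_, hΦ, _, hP⟩ => typF_mono S hΦ hP), fun _ _ _ S h => typF_mono S h⟩

end Paper
end
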